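/- arXiv:2403.08537 — 2 statements merged into one kernel-verified Lean document; each statement's English description precedes it below -/
import Mathlib

section
/- For S ⊆ {1,…,n} with u_x > 2 for all x ∈ S, define C_S = ∑_{A ⊆ {1,…,n}} (k_{S\A} mod char F) · B_{A, S∩A, A} ∈ T, where B_{A,B,C} = ∑_{AΔC ⊆ b ⊆ B} E*_A A_b E*_C and k_S = ∏_{x∈S}(u_x − 1). Then {C_S : S ⊆ {x : u_x > 2}} is an F-basis of the center Z(T) of the Terwilliger F-algebra T. -/
open Finset

variable {n : ℕ} {U : Fin n → Type*} [∀ i, Fintype (U i)] [∀ i, DecidableEq (U i)]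
variable (F : Type*) [Field F]

/-- `D(y,z) = {i : y i ≠ z i}`. -/
def Dst (y z : ∀ i, U i) : Finset (Fin n) := univ.filter (fun i => y i ≠ z i)

/-- Adjacency matrix of the relation indexed by `S`. -/
def adjMat (S : Finset (Fin n)) : Matrix (∀ i, U i) (∀ i, U i) F :=
  fun y z => if Dst y z = S then 1 else 0

/-- Dual idempotent with respect to the base point `x`. -/
def dualIdem (x : ∀ i, U i) (S : Finset (Fin n)) : Matrix (∀ i, U i) (∀ i, U i) F :=
  Matrix.diagonal (fun y => if Dst x y = S then 1 else 0)

/-- The Terwilliger `F`-algebra of the factorial scheme with base point `x`. -/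
def TerwAlg (x : ∀ i, U i) : Subalgebra F (Matrix (∀ i, U i) (∀ i, U i) F) :=
  Algebra.adjoin F (Set.range (adjMat F) ∪ Set.range (dualIdem F x))

/-- `B_{A,B,C} = ∑_{AΔC ⊆ b ⊆ B} E*_A A_b E*_C`. -/
def Bmat (x : ∀ i, U i) (A B C : Finset (Fin n)) : Matrix (∀ i, U i) (∀ i, U i) F :=
  ∑ b ∈ B.powerset.filter (fun b => symmDiff A C ⊆ b),
    dualIdem F x A * adjMat F b * dualIdem F x C

/-- `k_S = ∏_{x ∈ S} (u_x - 1)`. -/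
def kval (u : Fin n → ℕ) (S : Finset (Fin n)) : ℕ := ∏ i ∈ S, (u i - 1)

/-- The central elements `C_S`. -/
def Cmat (u : Fin n → ℕ) (x : ∀ i, U i) (S : Finset (Fin n)) :
    Matrix (∀ i, U i) (∀ i, U i) F :=
  ∑ A ∈ (univ : Finset (Finset (Fin n))), (kval u (S \ A) : F) • Bmat F x A (S ∩ A) A

set_option linter.unusedSectionVars false

/-- Product (tensor) matrices. -/
def tensM (M : ∀ i, Matrix (U i) (U i) F) : Matrix (∀ i, U i) (∀ i, U i) F :=
  fun y z => ∏ i, M i (y i) (z i)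

lemma tensM_mul (M N : ∀ i, Matrix (U i) (U i) F) :
    tensM F M * tensM F N = tensM F (fun i => M i * N i) := by
  ext y z
  simp only [tensM, Matrix.mul_apply, Finset.prod_univ_sum, Fintype.piFinset_univ,
    Finset.prod_mul_distrib]

lemma tensM_comm (M N : ∀ i, Matrix (U i) (U i) F) (h : ∀ i, M i * N i = N i * M i) :
    tensM F M * tensM F N = tensM F N * tensM F M := by
  rw [tensM_mul, tensM_mul]
  simp only [h]

lemma prod_ite_prop (P : Fin n → Prop) [DecidablePred P] [Decidable (∀ i, P i)] :
    (∏ i, if P i then (1 : F) else 0) = if ∀ i, P i then 1 else 0 := by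
  rw [Finset.prod_ite_zero]
  simp

lemma adjMat_eq (S : Finset (Fin n)) :
    adjMat (U := U) F S = tensM F (fun i a b => if (a ≠ b ↔ i ∈ S) then 1 else 0) := by
  classical
  ext y z
  simp only [adjMat, tensM]
  rw [prod_ite_prop F (fun i => (y i ≠ z i ↔ i ∈ S))]
  simp [Dst, Finset.ext_iff]

lemma dualIdem_eq (x : ∀ i, U i) (S : Finset (Fin n)) :
    dualIdem F x S =
      tensM F (fun i => Matrix.diagonal (fun a => if (x i ≠ a ↔ i ∈ S) then 1 else 0)) := by
  classical
  ext y z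
  simp only [dualIdem, tensM, Matrix.diagonal_apply]
  by_cases h : y = z
  · subst h
    simp only [if_true]
    rw [prod_ite_prop F (fun i => (x i ≠ y i ↔ i ∈ S))]
    simp [Dst, Finset.ext_iff]
  · rw [if_neg h]
    obtain ⟨i, hi⟩ := Function.ne_iff.mp h
    rw [Finset.prod_eq_zero (Finset.mem_univ i)]
    simp [hi]

/-- Local factor of `C_S`. -/
def cfac (x : ∀ i, U i) (S : Finset (Fin n)) (i : Fin n) : Matrix (U i) (U i) F :=
  if i ∈ S then
    Matrix.of (fun a b =>
      if a = x i then (if b = x i then ((Fintype.card (U i) - 1 : ℕ) : F) else 0)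
      else (if b = x i then 0 else 1))
  else 1

lemma triple_apply (x : ∀ i, U i) (A b C : Finset (Fin n)) (y z : ∀ i, U i) :
    (dualIdem F x A * adjMat F b * dualIdem F x C :
      Matrix (∀ i, U i) (∀ i, U i) F) y z =
      if Dst x y = A ∧ Dst y z = b ∧ Dst x z = C then 1 else 0 := by
  simp only [dualIdem, Matrix.mul_diagonal, Matrix.diagonal_mul, adjMat]
  by_cases h1 : Dst x y = A <;> by_cases h2 : Dst y z = b <;> by_cases h3 : Dst x z = C <;>
    simp [h1, h2, h3]

lemma Bmat_apply (x : ∀ i, U i) (A B : Finset (Fin n)) (y z : ∀ i, U i) :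
    Bmat F x A B A y z = if Dst x y = A ∧ Dst x z = A ∧ Dst y z ⊆ B then 1 else 0 := by
  simp only [Bmat, Matrix.sum_apply, triple_apply]
  by_cases h1 : Dst x y = A
  · by_cases h3 : Dst x z = A
    · simp only [h1, h3, true_and, and_true]
      rw [Finset.sum_ite_eq]
      simp
    · simp [h3]
  · simp [h1]

lemma Cmat_apply (u : Fin n → ℕ) (x : ∀ i, U i) (S : Finset (Fin n)) (y z : ∀ i, U i) :
    Cmat F u x S y z =
      if Dst x y = Dst x z ∧ Dst y z ⊆ S then (kval u (S \ Dst x y) : F) else 0 := by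
  simp only [Cmat, Matrix.sum_apply, Matrix.smul_apply, Bmat_apply, smul_eq_mul]
  rw [Finset.sum_eq_single (Dst x y)]
  · by_cases h : Dst x y = Dst x z
    · have h' : Dst y z ⊆ Dst x y := by
        intro i hi
        by_contra hc
        have hc' := hc
        rw [h] at hc'
        simp [Dst] at hi hc hc'
        exact hi (hc.symm.trans hc')
      have : Dst y z ⊆ S ∩ Dst x y ↔ Dst y z ⊆ S := by
        rw [Finset.subset_inter_iff]; simp [h']
      simp only [← h, this, true_and]
      simp
    · have : Dst x z ≠ Dst x y := fun e => h e.symm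
      simp [h, this]
  · intro A _ hA
    rw [if_neg (fun e => hA e.1.symm), mul_zero]
  · simp

lemma Cmat_eq (u : Fin n → ℕ) (hu : ∀ i, Fintype.card (U i) = u i) (x : ∀ i, U i)
    (S : Finset (Fin n)) : Cmat F u x S = tensM F (cfac F x S) := by
  classical
  ext y z
  rw [Cmat_apply]
  simp only [tensM]
  have key : ∀ i, cfac F x S i (y i) (z i) =
      (if (x i ≠ y i ↔ x i ≠ z i) ∧ (y i ≠ z i → i ∈ S) then 1 else 0) *
      (if i ∈ S \ Dst x y then ((u i - 1 : ℕ) : F) else 1) := by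
    intro i
    have hui := hu i
    unfold cfac
    by_cases hS : i ∈ S
    · by_cases h1 : y i = x i <;> by_cases h2 : z i = x i <;>
        simp [hS, Dst, h1, h2, hui, eq_comm (a := x i)]
    · by_cases h : y i = z i
      · simp [hS, h, Matrix.one_apply]
      · simp [hS, h, Matrix.one_apply]
  simp only [key]
  rw [Finset.prod_mul_distrib, prod_ite_prop F]
  have e1 : (∀ i, (x i ≠ y i ↔ x i ≠ z i) ∧ (y i ≠ z i → i ∈ S)) ↔
      (Dst x y = Dst x z ∧ Dst y z ⊆ S) := by
    simp only [Dst, Finset.ext_iff, Finset.subset_iff, Finset.mem_filter, Finset.mem_univ,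
      true_and, forall_and]
  have e2 : (∏ i, if i ∈ S \ Dst x y then ((u i - 1 : ℕ) : F) else 1) =
      (kval u (S \ Dst x y) : F) := by
    rw [Finset.prod_ite_mem]
    simp [kval]
  rw [e2]
  simp only [e1]
  split_ifs <;> simp

lemma cfac_comm_diag (x : ∀ i, U i) (S : Finset (Fin n)) (i : Fin n) (p : Prop) [Decidable p] :
    cfac F x S i * Matrix.diagonal (fun a => if (x i ≠ a ↔ p) then (1 : F) else 0) =
      Matrix.diagonal (fun a => if (x i ≠ a ↔ p) then (1 : F) else 0) * cfac F x S i := by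
  unfold cfac
  by_cases hS : i ∈ S
  · ext a b
    rw [Matrix.mul_diagonal, Matrix.diagonal_mul]
    by_cases h1 : a = x i <;> by_cases h2 : b = x i <;>
        simp [hS, h1, h2, eq_comm (a := x i)]
  · simp [hS]

lemma cfac_comm_adj (x : ∀ i, U i) (S : Finset (Fin n)) (i : Fin n) (p : Prop) [Decidable p] :
    cfac F x S i * (Matrix.of (fun a b => if (a ≠ b ↔ p) then (1 : F) else 0) : Matrix (U i) (U i) F) =
      (Matrix.of (fun a b => if (a ≠ b ↔ p) then (1 : F) else 0) : Matrix (U i) (U i) F) * cfac F x S i := by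
  by_cases hp : p
  · have e : (Matrix.of (fun a b => if (a ≠ b ↔ p) then (1 : F) else 0) : Matrix (U i) (U i) F) =
        Matrix.of (fun _ _ => (1 : F)) - 1 := by
      ext a b
      by_cases h : a = b <;> simp [hp, h, Matrix.one_apply]
    rw [e, mul_sub, sub_mul, mul_one, one_mul]
    congr 1
    unfold cfac
    by_cases hS : i ∈ S
    · have hc : (∑ w : U i, if w = x i then (0 : F) else 1) =
          ((Fintype.card (U i) - 1 : ℕ) : F) := by
        rw [Finset.sum_ite]
        simp [Finset.filter_ne', Finset.card_erase_of_mem, Finset.card_univ]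
      ext a b
      rw [if_pos hS, Matrix.mul_apply, Matrix.mul_apply]
      simp only [Matrix.of_apply, mul_one, one_mul]
      have r : (∑ w : U i, if a = x i then
          (if w = x i then ((Fintype.card (U i) - 1 : ℕ) : F) else 0)
          else (if w = x i then 0 else 1)) = ((Fintype.card (U i) - 1 : ℕ) : F) := by
        by_cases h : a = x i
        · simp [h]
        · simp only [h, if_false]; exact hc
      have l : (∑ w : U i, if w = x i then
          (if b = x i then ((Fintype.card (U i) - 1 : ℕ) : F) else 0)
          else (if b = x i then 0 else 1)) = ((Fintype.card (U i) - 1 : ℕ) : F) := by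
        by_cases h : b = x i
        · simp [h]
        · simp only [h, if_false]; exact hc
      rw [r, l]
    · simp [hS]
  · have e : (Matrix.of (fun a b => if (a ≠ b ↔ p) then (1 : F) else 0) : Matrix (U i) (U i) F) = 1 := by
      ext a b
      by_cases h : a = b <;> simp [hp, h, Matrix.one_apply]
    rw [e, mul_one, one_mul]

lemma Cmat_mem (u : Fin n → ℕ) (x : ∀ i, U i) (S : Finset (Fin n)) :
    Cmat F u x S ∈ TerwAlg F x := by
  unfold Cmat Bmat
  refine Subalgebra.sum_mem _ fun A _ => Subalgebra.smul_mem _ (Subalgebra.sum_mem _ fun b _ => ?_) _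
  refine Subalgebra.mul_mem _ (Subalgebra.mul_mem _ ?_ ?_) ?_
  · exact Algebra.subset_adjoin (Or.inr ⟨_, rfl⟩)
  · exact Algebra.subset_adjoin (Or.inl ⟨_, rfl⟩)
  · exact Algebra.subset_adjoin (Or.inr ⟨_, rfl⟩)

lemma Cmat_central (u : Fin n → ℕ) (hu : ∀ i, Fintype.card (U i) = u i) (x : ∀ i, U i)
    (S : Finset (Fin n)) (t : Matrix (∀ i, U i) (∀ i, U i) F) (ht : t ∈ TerwAlg F x) :
    Cmat F u x S * t = t * Cmat F u x S := by
  have : TerwAlg F x ≤ Subalgebra.centralizer F {Cmat F u x S} := by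
    refine Algebra.adjoin_le ?_
    rintro t (⟨A, rfl⟩ | ⟨A, rfl⟩)
    · simp only [SetLike.mem_coe, Subalgebra.mem_centralizer_iff, Set.mem_singleton_iff,
        forall_eq]
      rw [Cmat_eq F u hu, adjMat_eq]
      exact tensM_comm F _ _ fun i => cfac_comm_adj F x S i (i ∈ A)
    · simp only [SetLike.mem_coe, Subalgebra.mem_centralizer_iff, Set.mem_singleton_iff,
        forall_eq]
      rw [Cmat_eq F u hu, dualIdem_eq]
      exact tensM_comm F _ _ fun i => cfac_comm_diag F x S i (i ∈ A)
  exact (Subalgebra.mem_centralizer_iff F).1 (this ht) _ rfl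

lemma TerwAlg_invariant (x : ∀ i, U i) (σ : ∀ i, Equiv.Perm (U i)) (hσ : ∀ i, σ i (x i) = x i)
    (m : Matrix (∀ i, U i) (∀ i, U i) F) (hm : m ∈ TerwAlg F x) (y z : ∀ i, U i) :
    m (fun i => σ i (y i)) (fun i => σ i (z i)) = m y z := by
  have hx : ∀ y : ∀ i, U i, Dst x (fun i => σ i (y i)) = Dst x y := by
    intro y
    ext i
    simp only [Dst, Finset.mem_filter, Finset.mem_univ, true_and]
    conv_lhs => rw [← hσ i]
    exact (σ i).injective.ne_iff
  have hd : ∀ y z : ∀ i, U i, Dst (fun i => σ i (y i)) (fun i => σ i (z i)) = Dst y z := by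
    intro y z
    simp [Dst]
  have hinj : ∀ y z : ∀ i, U i, (fun i => σ i (y i)) = (fun i => σ i (z i)) ↔ y = z := by
    intro y z
    simp [funext_iff]
  induction hm using Algebra.adjoin_induction generalizing y z with
  | mem t ht =>
    rcases ht with ⟨A, rfl⟩ | ⟨A, rfl⟩
    · simp only [adjMat, hd]
    · simp only [dualIdem, Matrix.diagonal_apply, hx, hinj]
  | algebraMap r =>
    simp only [Matrix.algebraMap_matrix_apply, hinj]
  | add a b _ _ ha hb => simp only [Matrix.add_apply, ha, hb]
  | mul a b _ _ ha hb =>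
    simp only [Matrix.mul_apply]
    rw [← (Equiv.piCongrRight σ).sum_comp]
    refine Finset.sum_congr rfl fun w _ => ?_
    have : (Equiv.piCongrRight σ) w = fun i => σ i (w i) := rfl
    rw [this, ha, hb]

lemma exists_perm {α : Type*} [DecidableEq α] (x y z y' z' : α) (hy : y ≠ x) (hz : z ≠ x)
    (hy' : y' ≠ x) (hz' : z' ≠ x) (h : y = z ↔ y' = z') :
    ∃ σ : Equiv.Perm α, σ x = x ∧ σ y = y' ∧ σ z = z' := by
  by_cases e : y = z
  · have e' := h.1 e
    subst e e'
    exact ⟨Equiv.swap y y', Equiv.swap_apply_of_ne_of_ne hy.symm hy'.symm,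
      Equiv.swap_apply_left _ _, Equiv.swap_apply_left _ _⟩
  · have e' : y' ≠ z' := fun c => e (h.2 c)
    have h1 : Equiv.swap y y' x = x := Equiv.swap_apply_of_ne_of_ne hy.symm hy'.symm
    have h2 : Equiv.swap y y' y = y' := Equiv.swap_apply_left _ _
    have h3 : Equiv.swap y y' z ≠ x := by
      intro c
      exact hz ((Equiv.swap y y').injective (c.trans h1.symm))
    have h4 : Equiv.swap y y' z ≠ y' := by
      intro c
      exact e ((Equiv.swap y y').injective (c.trans h2.symm)).symm
    refine ⟨Equiv.swap (Equiv.swap y y' z) z' * Equiv.swap y y', ?_, ?_, ?_⟩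
    · rw [Equiv.Perm.mul_apply, h1]; exact Equiv.swap_apply_of_ne_of_ne h3.symm hz'.symm
    · rw [Equiv.Perm.mul_apply, h2]; exact Equiv.swap_apply_of_ne_of_ne h4.symm e'
    · rw [Equiv.Perm.mul_apply]; exact Equiv.swap_apply_left _ _

lemma TerwAlg_type (x : ∀ i, U i) (m : Matrix (∀ i, U i) (∀ i, U i) F) (hm : m ∈ TerwAlg F x)
    (y z y' z' : ∀ i, U i) (hy : ∀ i, y i ≠ x i) (hz : ∀ i, z i ≠ x i) (hy' : ∀ i, y' i ≠ x i)
    (hz' : ∀ i, z' i ≠ x i) (h : ∀ i, y i = z i ↔ y' i = z' i) : m y z = m y' z' := by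
  choose σ h1 h2 h3 using fun i =>
    exists_perm (x i) (y i) (z i) (y' i) (z' i) (hy i) (hz i) (hy' i) (hz' i) (h i)
  rw [← TerwAlg_invariant F x σ h1 m hm y z]
  simp only [h2, h3]

/-- A central element vanishing on the top block is zero. -/
lemma central_vanish (h2 : ∀ i, 2 ≤ Fintype.card (U i)) (x : ∀ i, U i)
    (m : Matrix (∀ i, U i) (∀ i, U i) F) (hc : ∀ t ∈ TerwAlg F x, m * t = t * m)
    (h0 : ∀ y z, (∀ i, y i ≠ x i) → (∀ i, z i ≠ x i) → m y z = 0) : m = 0 := by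
  classical
  have hblock : ∀ y z, Dst x y ≠ Dst x z → m y z = 0 := by
    intro y z h
    have := congrFun (congrFun (hc (dualIdem F x (Dst x y))
      (Algebra.subset_adjoin (Or.inr ⟨_, rfl⟩))) y) z
    simp only [dualIdem, Matrix.mul_diagonal, Matrix.diagonal_mul] at this
    simpa [Ne.symm h] using this.symm
  have main : ∀ k : ℕ, ∀ y z, (Dst x y)ᶜ.card = k → m y z = 0 := by
    intro k
    induction k with
    | zero =>
      intro y z hk
      by_cases h : Dst x y = Dst x z
      · rw [Finset.card_eq_zero, Finset.compl_eq_empty_iff] at hk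
        rw [hk] at h
        refine h0 y z (fun i => ?_) (fun i => ?_)
        · have : i ∈ Dst x y := hk ▸ Finset.mem_univ i
          simp [Dst] at this
          exact Ne.symm this
        · have : i ∈ Dst x z := h ▸ Finset.mem_univ i
          simp [Dst] at this
          exact Ne.symm this
      · exact hblock y z h
    | succ k ih =>
      intro y z hk
      by_cases h : Dst x y = Dst x z
      swap
      · exact hblock y z h
      obtain ⟨i, hi⟩ : (Dst x y)ᶜ.Nonempty := by
        rw [← Finset.card_pos]; omega
      have hi' := hi
      rw [h] at hi'
      have hyi : x i = y i := by simpa [Dst] using hi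
      have hzi : x i = z i := by simpa [Dst] using hi'
      have : Nontrivial (U i) := Fintype.one_lt_card_iff_nontrivial.1 (h2 i)
      obtain ⟨c, hcx⟩ := exists_ne (x i)
      have hz'D : Dst x (Function.update z i c) = insert i (Dst x z) := by
        ext j
        by_cases hj : j = i
        · subst hj; simp [Dst, Ne.symm hcx]
        · simp [Dst, hj]
      have hcomm := congrFun (congrFun (hc (adjMat F {i})
        (Algebra.subset_adjoin (Or.inl ⟨_, rfl⟩))) y) (Function.update z i c)
      rw [Matrix.mul_apply, Matrix.mul_apply] at hcomm
      rw [Finset.sum_eq_single z, Finset.sum_eq_zero] at hcomm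
      · have : Dst z (Function.update z i c) = {i} := by
          ext j
          by_cases hj : j = i
          · subst hj; simp [Dst, ← hzi, Ne.symm hcx]
          · simp [Dst, hj]
        simpa [adjMat, this] using hcomm
      · intro w _
        by_cases hw : Dst x w = Dst x (Function.update z i c)
        · rw [ih w, mul_zero]
          rw [hw, hz'D, ← h, Finset.compl_insert, Finset.card_erase_of_mem hi, hk]
          rfl
        · rw [hblock _ _ hw, mul_zero]
      · intro w _ hwz
        by_cases hw : Dst y y = ∅ ∧ Dst x y = Dst x w
        · have hne : Dst w (Function.update z i c) ≠ {i} := by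
            intro e
            apply hwz
            funext j
            by_cases hj : j = i
            · subst hj
              rw [hw.2] at hi
              have : x j = w j := by simpa [Dst] using hi
              rw [← this, hzi]
            · have : j ∉ Dst w (Function.update z i c) := by rw [e]; simpa using hj
              simpa [Dst, hj] using this
          simp [adjMat, hne]
        · rw [hblock y w, zero_mul]
          intro e
          exact hw ⟨by simp [Dst], e⟩
      · simp
  ext y z
  exact main _ y z rfl

lemma upsum_zero {Q : Finset (Fin n)} (a : {S : Finset (Fin n) // S ⊆ Q} → F)
    (h : ∀ S : {S : Finset (Fin n) // S ⊆ Q},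
      ∑ S' : {S : Finset (Fin n) // S ⊆ Q}, (if S.val ⊆ S'.val then a S' else 0) = 0) :
    a = 0 := by
  have main : ∀ k : ℕ, ∀ S : {S : Finset (Fin n) // S ⊆ Q}, n - S.val.card = k → a S = 0 := by
    intro k
    induction k using Nat.strong_induction_on with
    | _ k ih =>
      intro S hS
      have := h S
      rw [Finset.sum_eq_single S] at this
      · simpa using this
      · intro S' _ hne
        by_cases hs : S.val ⊆ S'.val
        · rw [if_pos hs]
          have hlt : S.val.card < S'.val.card := Finset.card_lt_card
            (Finset.ssubset_iff_subset_ne.2 ⟨hs, fun e => hne (Subtype.ext e.symm)⟩)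
          have hle : S'.val.card ≤ n := by simpa using Finset.card_le_univ S'.val
          exact ih (n - S'.val.card) (by omega) S' rfl
        · rw [if_neg hs]
      · simp
  funext S
  exact main _ S rfl

lemma upsum_surj {Q : Finset (Fin n)} (g : {S : Finset (Fin n) // S ⊆ Q} → F) :
    ∃ a : {S : Finset (Fin n) // S ⊆ Q} → F, ∀ S : {S : Finset (Fin n) // S ⊆ Q},
      ∑ S' : {S : Finset (Fin n) // S ⊆ Q}, (if S.val ⊆ S'.val then a S' else 0) = g S := by
  let L : ({S : Finset (Fin n) // S ⊆ Q} → F) →ₗ[F] ({S : Finset (Fin n) // S ⊆ Q} → F) :=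
    { toFun := fun a S => ∑ S' : {S : Finset (Fin n) // S ⊆ Q}, (if S.val ⊆ S'.val then a S' else 0)
      map_add' := by
        intro a b
        funext S
        simp only [Pi.add_apply, ← Finset.sum_add_distrib]
        refine Finset.sum_congr rfl fun S' _ => ?_
        split_ifs <;> simp
      map_smul' := by
        intro r a
        funext S
        simp only [Pi.smul_apply, smul_eq_mul, RingHom.id_apply, Finset.mul_sum]
        refine Finset.sum_congr rfl fun S' _ => ?_
        split_ifs <;> simp }
  have hL : Function.Injective L := by
    rw [← LinearMap.ker_eq_bot, LinearMap.ker_eq_bot']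
    intro a ha
    exact upsum_zero F a fun S => congrFun ha S
  obtain ⟨a, ha⟩ := LinearMap.injective_iff_surjective.1 hL g
  exact ⟨a, fun S => congrFun ha S⟩

lemma exists_reps (u : Fin n → ℕ) (hu : ∀ i, Fintype.card (U i) = u i)
    (h2 : ∀ i, 2 ≤ u i) (x : ∀ i, U i) :
    ∃ y : ∀ i, U i, ∃ z : {S : Finset (Fin n) // S ⊆ univ.filter (fun i => 2 < u i)} → ∀ i, U i,
      (∀ i, y i ≠ x i) ∧ ∀ S, (∀ i, z S i ≠ x i) ∧ Dst y (z S) = S.val := by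
  classical
  have hy : ∀ i, ∃ a : U i, a ≠ x i := fun i => by
    have : Nontrivial (U i) := Fintype.one_lt_card_iff_nontrivial.1 (by rw [hu]; exact h2 i)
    exact exists_ne _
  choose y hy using hy
  have hz : ∀ i, ∃ b : U i, b ≠ x i ∧ (2 < u i → b ≠ y i) := fun i => by
    by_cases h : 2 < u i
    · have : ({x i, y i} : Finset (U i)).card < Fintype.card (U i) :=
        lt_of_le_of_lt Finset.card_le_two (by rw [hu]; exact h)
      obtain ⟨b, hb⟩ : (({x i, y i} : Finset (U i))ᶜ).Nonempty := by
        rw [← Finset.card_pos, Finset.card_compl]; omega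
      simp at hb
      exact ⟨b, hb.1, fun _ => hb.2⟩
    · exact ⟨y i, hy i, fun h' => absurd h' h⟩
  choose b hb hb' using hz
  refine ⟨y, fun S i => if i ∈ S.val then b i else y i, hy, fun S => ⟨fun i => ?_, ?_⟩⟩
  · dsimp only
    split_ifs
    · exact hb i
    · exact hy i
  · ext i
    by_cases h : i ∈ S.val
    · have := S.2 h
      simp at this
      simp [Dst, h, Ne.symm (hb' i this)]
    · simp [Dst, h]

lemma Cmat_top (u : Fin n → ℕ) (x : ∀ i, U i) (S : Finset (Fin n)) (y z : ∀ i, U i)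
    (hy : ∀ i, y i ≠ x i) (hz : ∀ i, z i ≠ x i) :
    Cmat F u x S y z = if Dst y z ⊆ S then 1 else 0 := by
  have e1 : Dst x y = univ := by ext i; simp [Dst, Ne.symm (hy i)]
  have e2 : Dst x z = univ := by ext i; simp [Dst, Ne.symm (hz i)]
  have e3 : S \ univ = ∅ := by ext i; simp
  rw [Cmat_apply, e1, e2, e3]
  simp [kval]

theorem stmt_12 (hn : 1 ≤ n) (u : Fin n → ℕ) (hu : ∀ i, Fintype.card (U i) = u i)
    (h2 : ∀ i, 2 ≤ u i) (x : ∀ i, U i) :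
    LinearIndependent F
        (fun S : {S : Finset (Fin n) // S ⊆ univ.filter (fun i => 2 < u i)} =>
          Cmat F u x S.val) ∧
      (Submodule.span F
          (Set.range (fun S : {S : Finset (Fin n) // S ⊆ univ.filter (fun i => 2 < u i)} =>
            Cmat F u x S.val)) : Set (Matrix (∀ i, U i) (∀ i, U i) F))
        = {m | m ∈ TerwAlg F x ∧ ∀ t ∈ TerwAlg F x, m * t = t * m} := by
  classical
  obtain ⟨y, z, hy, hz⟩ := exists_reps u hu h2 x
  have hsum : ∀ (a : {S : Finset (Fin n) // S ⊆ univ.filter (fun i => 2 < u i)} → F) S,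
      (∑ S', a S' • Cmat F u x S'.val) y (z S) =
        ∑ S' : {S : Finset (Fin n) // S ⊆ univ.filter (fun i => 2 < u i)},
          (if S.val ⊆ S'.val then a S' else 0) := by
    intro a S
    rw [Matrix.sum_apply]
    refine Finset.sum_congr rfl fun S' _ => ?_
    rw [Matrix.smul_apply, Cmat_top F u x _ _ _ hy (hz S).1, (hz S).2]
    simp
  constructor
  · rw [Fintype.linearIndependent_iff]
    intro a ha
    have : a = 0 := upsum_zero F a fun S => by
      rw [← hsum, ha]; rfl
    intro S
    rw [this]; rfl
  · ext m
    simp only [SetLike.mem_coe, Set.mem_ofPred_eq]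
    constructor
    · intro hm
      induction hm using Submodule.span_induction with
      | mem t ht =>
        obtain ⟨S, rfl⟩ := ht
        exact ⟨Cmat_mem F u x _, fun t ht => Cmat_central F u hu x _ t ht⟩
      | zero => exact ⟨Subalgebra.zero_mem _, fun t _ => by simp⟩
      | add a b _ _ ha hb =>
        exact ⟨Subalgebra.add_mem _ ha.1 hb.1, fun t ht => by
          rw [add_mul, mul_add, ha.2 t ht, hb.2 t ht]⟩
      | smul r a _ ha =>
        exact ⟨Subalgebra.smul_mem _ ha.1 r, fun t ht => by
          rw [smul_mul_assoc, mul_smul_comm, ha.2 t ht]⟩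
    · rintro ⟨hm, hc⟩
      obtain ⟨a, ha⟩ := upsum_surj F (fun S => m y (z S))
      have hmem : ∑ S', a S' • Cmat F u x S'.val ∈ TerwAlg F x :=
        Subalgebra.sum_mem _ fun S _ => Subalgebra.smul_mem _ (Cmat_mem F u x _) _
      have h0 : m - ∑ S', a S' • Cmat F u x S'.val = 0 := by
        refine central_vanish F (fun i => by rw [hu]; exact h2 i) x _ ?_ ?_
        · intro t ht
          rw [sub_mul, mul_sub, hc t ht, Finset.sum_mul, Finset.mul_sum]
          congr 1
          refine Finset.sum_congr rfl fun S _ => ?_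
          rw [smul_mul_assoc, mul_smul_comm, Cmat_central F u hu x _ t ht]
        · intro y' z' hy' hz'
          have hQ : Dst y' z' ⊆ univ.filter (fun i => 2 < u i) := by
            intro i hi
            have hi' : y' i ≠ z' i := by simpa [Dst] using hi
            simp only [Finset.mem_filter, Finset.mem_univ, true_and]
            rw [← hu, Fintype.two_lt_card_iff]
            exact ⟨y' i, z' i, x i, hi', hy' i, hz' i⟩
          rw [TerwAlg_type F x _ (Subalgebra.sub_mem _ hm hmem) y' z' y (z ⟨_, hQ⟩) hy' hz' hy
            (hz _).1]
          · rw [Matrix.sub_apply, hsum, ha, sub_self]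
          · intro i
            have := Finset.ext_iff.1 (hz ⟨_, hQ⟩).2 i
            have l : i ∈ Dst y (z ⟨_, hQ⟩) ↔ y i ≠ z ⟨_, hQ⟩ i := by
              rw [Dst, Finset.mem_filter]; simp
            have l' : i ∈ Dst y' z' ↔ y' i ≠ z' i := by
              rw [Dst, Finset.mem_filter]; simp
            exact (not_iff_not.1 (l.symm.trans (this.trans l'))).symm
      rw [sub_eq_zero.1 h0]
      exact Submodule.sum_mem _ fun S _ =>
        Submodule.smul_mem _ _ (Submodule.subset_span ⟨S, rfl⟩)
end

section
/- Suppose the set {a : u_a ≡ 1 (mod p)} is nonempty, where p = char F. Then the Jacobson radical Rad(T) of the Terwilliger F-algebra T of the factorial scheme is a nilpotent two-sided ideal whose nilpotency index equals 2·|{a : u_a ≡ 1 (mod p)}| + 1; that is, the product of any 2·|{a : u_a ≡ 1 (mod p)}| + 1 elements of Rad(T) is zero, and there exist 2·|{a : u_a ≡ 1 (mod p)}| elements of Rad(T) whose product is nonzero. -/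
open Finset

variable {n : ℕ} {U : Fin n → Type*} [∀ i, Fintype (U i)] [∀ i, DecidableEq (U i)]
variable (F : Type*) [Field F]

/-! ### One coordinate -/
section Local

variable {V : Type*} [Fintype V] [DecidableEq V]

def vv (x : V) (i : Bool) (y : V) : F := if (y = x) = (i = true) then 0 else 1

def ep (V : Type*) [Fintype V] : F := (Fintype.card V : F) - 1

def mu (V : Type*) [Fintype V] (i : Bool) : F := if i then ep F V else 1

def ee (x : V) (i j : Bool) : Matrix V V F := Matrix.vecMulVec (vv F x i) (vv F x j)

def ff (x : V) : Matrix V V F := Matrix.diagonal (vv F x true) - (ep F V)⁻¹ • ee F x true true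

def BB (x : V) : Option (Bool × Bool) → Matrix V V F
  | some (i, j) => ee F x i j
  | none => ff F x

def w0 : Option (Bool × Bool) → ℕ
  | some (i, j) => i.toNat + j.toNat
  | none => 0

open Classical in
noncomputable def ww (V : Type*) [Fintype V] (s : Option (Bool × Bool)) : ℕ := if ep F V = 0 then w0 s else 0

lemma vv_dot (x : V) (i j : Bool) :
    (vv F x i) ⬝ᵥ (vv F x j) = if i = j then mu F V i else 0 := by
  have h1 : ∀ y, vv F x false y = if y = x then 1 else 0 := by
    intro y; by_cases h : y = x <;> simp [vv, h]
  have h2 : ∀ y, vv F x true y = 1 - if y = x then 1 else 0 := by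
    intro y; by_cases h : y = x <;> simp [vv, h]
  cases i <;> cases j <;>
    simp [dotProduct, h1, h2, mu, ep, mul_sub, Finset.sum_sub_distrib]

lemma ee_mul (x : V) (i j k l : Bool) :
    ee F x i j * ee F x k l = (if j = k then mu F V j else 0) • ee F x i l := by
  unfold ee
  rw [Matrix.vecMulVec_mul_vecMulVec, vv_dot]
  ext a b
  by_cases h : j = k
  · simp [Matrix.vecMulVec_apply, h]; ring
  · simp [Matrix.vecMulVec_apply, h]

lemma diag_ee (x : V) (k l : Bool) :
    Matrix.diagonal (vv F x true) * ee F x k l = if k = true then ee F x k l else 0 := by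
  ext a b
  rw [Matrix.diagonal_mul]
  cases k <;> by_cases h : a = x <;> simp [ee, vv, Matrix.vecMulVec_apply, h]

lemma ee_diag (x : V) (k l : Bool) :
    ee F x k l * Matrix.diagonal (vv F x true) = if l = true then ee F x k l else 0 := by
  ext a b
  rw [Matrix.mul_diagonal]
  cases l <;> by_cases h : b = x <;> simp [ee, vv, Matrix.vecMulVec_apply, h]

def kap (V : Type*) [Fintype V] : F := 1 - (ep F V)⁻¹ * ep F V

lemma ff_ee (x : V) (k l : Bool) :
    ff F x * ee F x k l = (if k = true then kap F V else 0) • ee F x k l := by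
  unfold ff
  rw [sub_mul, diag_ee, smul_mul_assoc, ee_mul, smul_smul]
  cases k <;> simp [kap, mu, sub_smul]

lemma ee_ff (x : V) (k l : Bool) :
    ee F x k l * ff F x = (if l = true then kap F V else 0) • ee F x k l := by
  unfold ff
  rw [mul_sub, ee_diag, mul_smul_comm, ee_mul, smul_smul]
  cases l <;> simp [kap, mu, sub_smul]

lemma ep_kap : (ep F V)⁻¹ * kap F V = 0 := by
  unfold kap
  by_cases h : ep F V = 0
  · simp [h]
  · field_simp; simp

lemma ff_ff (x : V) : ff F x * ff F x = ff F x := by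
  have h : Matrix.diagonal (vv F x true) * ff F x = ff F x := by
    unfold ff
    rw [mul_sub, mul_smul_comm, diag_ee, Matrix.diagonal_mul_diagonal]
    have : (fun i => vv F x true i * vv F x true i) = vv F x true := by
      ext i; by_cases h : i = x <;> simp [vv, h]
    rw [this]; simp
  conv_lhs => enter [1]; unfold ff
  rw [sub_mul, h, smul_mul_assoc, ee_ff, smul_smul]
  simp [ep_kap]

lemma BB_mul (x : V) (s t : Option (Bool × Bool)) :
    BB F x s * BB F x t = 0 ∨
      ∃ (g : F) (r : Option (Bool × Bool)), BB F x s * BB F x t = g • BB F x r ∧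
        ww F V s + ww F V t ≤ ww F V r := by
  rcases s with _ | ⟨i, j⟩ <;> rcases t with _ | ⟨k, l⟩
  · right; exact ⟨1, none, by simp [BB, ff_ff], by simp [ww, w0]⟩
  · right; exact ⟨_, some (k, l), ff_ee F x k l, by simp [ww, w0]⟩
  · right; exact ⟨_, some (i, j), ee_ff F x i j, by simp [ww, w0]⟩
  · by_cases h : (if j = k then mu F V j else 0) = 0
    · left; simp only [BB]; rw [ee_mul, h, zero_smul]
    · right
      refine ⟨_, some (i, l), ee_mul F x i j k l, ?_⟩
      unfold ww
      split_ifs with h0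
      · cases j <;> cases k <;> simp [mu, h0, w0] at h ⊢
      · simp

def lef : Option (Bool × Bool) → Option (Bool × Bool)
  | some (i, _) => some (false, i)
  | none => none
def rig : Option (Bool × Bool) → Option (Bool × Bool)
  | some (_, j) => some (j, false)
  | none => none
def lef' : Option (Bool × Bool) → Option (Bool × Bool)
  | some (i, _) => some (i, false)
  | none => none
def rig' : Option (Bool × Bool) → Option (Bool × Bool)
  | some (_, j) => some (false, j)
  | none => none
def pp : Option (Bool × Bool) → Option (Bool × Bool)
  | some _ => some (false, false)
  | none => none

lemma pp_idem (x : V) (t : Option (Bool × Bool)) :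
    BB F x (pp t) * BB F x (pp t) = BB F x (pp t) := by
  rcases t with _ | ⟨i, j⟩
  · simp [BB, pp, ff_ff]
  · simp [BB, pp, ee_mul, mu]

lemma recov (x : V) (t : Option (Bool × Bool)) :
    BB F x (lef' t) * BB F x (pp t) * BB F x (rig' t) = BB F x t := by
  rcases t with _ | ⟨i, j⟩
  · simp [BB, pp, lef', rig', ff_ff]
  · simp [BB, pp, lef', rig', ee_mul, mu]

lemma sand_self (x : V) (t : Option (Bool × Bool)) (ht : ww F V t = 0) :
    ∃ K : F, K ≠ 0 ∧ BB F x (lef t) * BB F x t * BB F x (rig t) = K • BB F x (pp t) := by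
  rcases t with _ | ⟨i, j⟩
  · exact ⟨1, one_ne_zero, by simp [BB, pp, lef, rig, ff_ff]⟩
  · refine ⟨mu F V i * mu F V j, ?_, by simp [BB, pp, lef, rig, ee_mul, smul_smul]⟩
    by_cases h : ep F V = 0
    · cases i <;> cases j <;> simp [ww, w0, h, mu] at ht ⊢
    · cases i <;> cases j <;> simp [h, mu]

lemma kap_zero (h : ep F V ≠ 0) : kap F V = 0 := by
  simp [kap, h]

lemma sand_ne (x : V) (t s : Option (Bool × Bool)) (ht : ww F V t = 0) (hs : ww F V s = 0)
    (hst : s ≠ t) : BB F x (lef t) * BB F x s * BB F x (rig t) = 0 := by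
  by_cases h : ep F V = 0
  · rcases t with _ | ⟨i, j⟩ <;> rcases s with _ | ⟨k, l⟩
    · simp at hst
    · cases k <;> cases l <;> simp [ww, w0, h] at ht hs
      simp [BB, lef, rig, ff_ee]
    · cases i <;> cases j <;> simp [ww, w0, h] at ht hs
      simp [BB, lef, rig, ee_ff]
    · cases k <;> cases l <;> cases i <;> cases j <;> simp [ww, w0, h] at ht hs hst
  · have hk := kap_zero F h
    rcases t with _ | ⟨i, j⟩ <;> rcases s with _ | ⟨k, l⟩
    · simp at hst
    · simp [BB, lef, rig, ff_ee, hk]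
    · simp [BB, lef, rig, ee_ff, hk]
    · simp only [BB, lef, rig, ee_mul, smul_mul_assoc, smul_smul]
      by_cases hik : i = k
      · by_cases hjl : l = j
        · subst hik hjl; simp at hst
        · simp [hjl]
      · simp [hik]

lemma w0_le (s : Option (Bool × Bool)) : w0 s ≤ 2 := by
  rcases s with _ | ⟨i, j⟩
  · simp [w0]
  · cases i <;> cases j <;> simp [w0]

lemma E0_eq (x : V) : Matrix.diagonal (vv F x false) = ee F x false false := by
  ext a b
  rw [Matrix.diagonal_apply]
  by_cases h : a = b
  · subst h; by_cases h : a = x <;> simp [ee, vv, Matrix.vecMulVec_apply, h]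
  · by_cases h' : a = x
    · have : b ≠ x := by rintro rfl; exact h h'
      simp [ee, vv, Matrix.vecMulVec_apply, h, this]
    · simp [ee, vv, Matrix.vecMulVec_apply, h, h']

lemma E1_eq (x : V) : Matrix.diagonal (vv F x true) = ff F x + (ep F V)⁻¹ • ee F x true true := by
  simp [ff]

lemma one_eq (x : V) : (1 : Matrix V V F) =
    Matrix.diagonal (vv F x false) + Matrix.diagonal (vv F x true) := by
  rw [Matrix.diagonal_add, ← Matrix.diagonal_one]
  congr 1; ext a; by_cases h : a = x <;> simp [vv, h]

def JJ (V : Type*) : Matrix V V F := fun _ _ => 1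

lemma JJ_eq (x : V) : JJ F V = ee F x false false + ee F x false true + ee F x true false
    + ee F x true true := by
  ext a b
  by_cases h : a = x <;> by_cases h' : b = x <;>
    simp [JJ, ee, vv, Matrix.vecMulVec_apply, h, h']

lemma ee_eq_JJ (x : V) (i j : Bool) : ee F x i j =
    Matrix.diagonal (vv F x i) * JJ F V * Matrix.diagonal (vv F x j) := by
  ext a b
  rw [Matrix.mul_diagonal, Matrix.diagonal_mul]
  simp [ee, JJ, Matrix.vecMulVec_apply]

/-- span of the local basis -/
def LS (x : V) : Submodule F (Matrix V V F) := Submodule.span F (Set.range (BB F x))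

lemma ee_mem (x : V) (i j : Bool) : ee F x i j ∈ LS F x :=
  Submodule.subset_span ⟨some (i, j), rfl⟩
lemma ff_mem (x : V) : ff F x ∈ LS F x :=
  Submodule.subset_span ⟨none, rfl⟩
lemma diag_mem (x : V) (i : Bool) : Matrix.diagonal (vv F x i) ∈ LS F x := by
  cases i
  · rw [E0_eq]; exact ee_mem F x _ _
  · rw [E1_eq]; exact add_mem (ff_mem F x) (Submodule.smul_mem _ _ (ee_mem F x _ _))
lemma one_mem_LS (x : V) : (1 : Matrix V V F) ∈ LS F x := by
  rw [one_eq F x]; exact add_mem (diag_mem F x _) (diag_mem F x _)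
lemma JJ_mem (x : V) : JJ F V ∈ LS F x := by
  rw [JJ_eq F x]
  exact add_mem (add_mem (add_mem (ee_mem F x _ _) (ee_mem F x _ _)) (ee_mem F x _ _))
    (ee_mem F x _ _)

lemma ff_bad (x : V) (h : ep F V = 0) (l : Bool) : ff F x * ee F x true l = ee F x true l := by
  rw [ff_ee]; simp [kap, h]

lemma ee_bad (x : V) (h : ep F V = 0) (k : Bool) : ee F x k true * ff F x = ee F x k true := by
  rw [ee_ff]; simp [kap, h]

end Local

/-! ### Products -/
section Global

lemma ring_aux {A : Type*} [Ring A] (z q P : A) :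
    z * (-q + 1) * P = -(z * (q - P) * P) + z * (P - P * P) := by
  noncomm_ring

def pm (m : ∀ i, Matrix (U i) (U i) F) : Matrix (∀ i, U i) (∀ i, U i) F :=
  fun y z => ∏ i, m i (y i) (z i)

lemma pm_mul (m m' : ∀ i, Matrix (U i) (U i) F) :
    pm F m * pm F m' = pm F (fun i => m i * m' i) := by
  ext y z
  simp only [pm, Matrix.mul_apply]
  rw [Finset.prod_univ_sum, Fintype.piFinset_univ]
  exact Finset.sum_congr rfl fun w _ => by rw [Finset.prod_mul_distrib]

lemma pm_smul (c : Fin n → F) (m : ∀ i, Matrix (U i) (U i) F) :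
    pm F (fun i => c i • m i) = (∏ i, c i) • pm F m := by
  ext y z
  simp [pm, Finset.prod_mul_distrib]

lemma pm_zero (m : ∀ i, Matrix (U i) (U i) F) (i : Fin n) (h : m i = 0) : pm F m = 0 := by
  ext y z
  exact Finset.prod_eq_zero (Finset.mem_univ i) (by simp [h])

abbrev Ty (n : ℕ) := Fin n → Option (Bool × Bool)

def PB (x : ∀ i, U i) (t : Ty n) : Matrix (∀ i, U i) (∀ i, U i) F :=
  pm F (fun i => BB F (x i) (t i))

noncomputable def wt (U : Fin n → Type*) [∀ i, Fintype (U i)] (t : Ty n) : ℕ :=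
  ∑ i, ww F (U i) (t i)

def NN (x : ∀ i, U i) (k : ℕ) : Submodule F (Matrix (∀ i, U i) (∀ i, U i) F) :=
  Submodule.span F {M | ∃ t : Ty n, k ≤ wt F U t ∧ PB F x t = M}

lemma PB_mem (x : ∀ i, U i) (t : Ty n) (k : ℕ) (h : k ≤ wt F U t) : PB F x t ∈ NN F x k :=
  Submodule.subset_span ⟨t, h, rfl⟩

lemma NN_mul (x : ∀ i, U i) (k l : ℕ) {A B : Matrix (∀ i, U i) (∀ i, U i) F}
    (hA : A ∈ NN F x k) (hB : B ∈ NN F x l) : A * B ∈ NN F x (k + l) := by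
  have : NN F x k * NN F x l ≤ NN F x (k + l) := by
    conv_lhs => unfold NN
    rw [Submodule.span_mul_span, Submodule.span_le]
    rintro _ ⟨_, ⟨t, ht, rfl⟩, _, ⟨s, hs, rfl⟩, rfl⟩
    simp only [PB, pm_mul, SetLike.mem_coe]
    by_cases h : ∃ i, BB F (x i) (t i) * BB F (x i) (s i) = 0
    · obtain ⟨i, hi⟩ := h
      rw [pm_zero F _ i hi]; exact zero_mem _
    · push Not at h
      have h' := fun i => (BB_mul F (x i) (t i) (s i)).resolve_left (h i)
      choose g r hr hw using h'
      simp only [hr]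
      rw [pm_smul]
      refine Submodule.smul_mem _ _ (PB_mem F x r _ ?_)
      refine le_trans (add_le_add ht hs) ?_
      unfold wt
      rw [← Finset.sum_add_distrib]
      exact Finset.sum_le_sum fun i _ => hw i
  exact this (Submodule.mul_mem_mul hA hB)

lemma NN_anti (x : ∀ i, U i) {k l : ℕ} (h : k ≤ l) : NN F x l ≤ NN F x k :=
  Submodule.span_mono fun _ ⟨t, ht, e⟩ => ⟨t, h.trans ht, e⟩

lemma pm_mem (x : ∀ i, U i) (m : ∀ i, Matrix (U i) (U i) F) (h : ∀ i, m i ∈ LS F (x i)) :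
    pm F m ∈ NN F x 0 := by
  have h' := fun i => (Submodule.mem_span_range_iff_exists_fun F).1 (h i)
  choose c hc using h'
  have : pm F m = ∑ t : Ty n, (∏ i, c i (t i)) • PB F x t := by
    ext y z
    simp only [pm, PB, ← hc, Matrix.sum_apply, Matrix.smul_apply, smul_eq_mul]
    rw [Finset.prod_univ_sum, Fintype.piFinset_univ]
    exact Finset.sum_congr rfl fun w _ => by rw [Finset.prod_mul_distrib]
  rw [this]
  exact Submodule.sum_mem _ fun t _ => Submodule.smul_mem _ _ (PB_mem F x t 0 (Nat.zero_le _))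

lemma adj_eq (S : Finset (Fin n)) : adjMat F (U := U) S =
    pm F (fun i => if i ∈ S then JJ F (U i) - 1 else 1) := by
  ext y z
  simp only [adjMat, pm]
  split_ifs with h
  · subst h
    rw [Finset.prod_eq_one]
    intro i _
    by_cases h : y i = z i
    · simp only [Dst, h, ne_eq, Finset.mem_filter, not_true, and_false, if_false]
      exact Matrix.one_apply_eq _
    · simp [Dst, h, JJ]
  · symm
    have : ∃ i, ¬ (y i ≠ z i ↔ i ∈ S) := by
      by_contra hh
      push Not at hh
      apply h
      ext i
      simpa [Dst] using hh i
    obtain ⟨i, hi⟩ := this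
    refine Finset.prod_eq_zero (Finset.mem_univ i) ?_
    by_cases h1 : i ∈ S <;> by_cases h2 : y i = z i <;> simp_all [JJ]

lemma dual_eq (x : ∀ i, U i) (S : Finset (Fin n)) : dualIdem F x S =
    pm F (fun i => Matrix.diagonal (vv F (x i) (decide (i ∈ S)))) := by
  ext y z
  simp only [dualIdem, pm, Matrix.diagonal_apply]
  split_ifs with h h'
  · subst h h'
    rw [Finset.prod_eq_one]
    intro i _
    by_cases h : y i = x i
    · simp [Dst, h, vv]
    · simp [Dst, h, Ne.symm h, vv]
  · subst h
    symm
    have : ∃ i, ¬ (x i ≠ y i ↔ i ∈ S) := by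
      by_contra hh
      push Not at hh
      apply h'
      ext i
      simpa [Dst] using hh i
    obtain ⟨i, hi⟩ := this
    refine Finset.prod_eq_zero (Finset.mem_univ i) ?_
    by_cases h1 : i ∈ S <;> by_cases h2 : x i = y i
    · simp [vv, h1, h2]
    · simp_all
    · simp_all
    · simp [vv, h1, Ne.symm h2]
  · symm
    obtain ⟨i, hi⟩ := Function.ne_iff.1 h
    exact Finset.prod_eq_zero (Finset.mem_univ i) (by simp [hi])

lemma pm_one : pm F (fun i => (1 : Matrix (U i) (U i) F)) = 1 := by
  have := adj_eq F (U := U) ∅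
  simp only [Finset.notMem_empty, if_false] at this
  rw [← this]
  ext y z
  simp only [adjMat, Dst, Matrix.one_apply, Finset.filter_eq_empty_iff, funext_iff]
  simp

lemma one_mem_NN (x : ∀ i, U i) : (1 : Matrix (∀ i, U i) (∀ i, U i) F) ∈ NN F x 0 := by
  rw [← pm_one]; exact pm_mem F x _ fun i => one_mem_LS F (x i)

lemma T_le (x : ∀ i, U i) {M : Matrix (∀ i, U i) (∀ i, U i) F} (hM : M ∈ TerwAlg F x) :
    M ∈ NN F x 0 := by
  induction hM using Algebra.adjoin_induction with
  | mem M h =>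
    rcases h with ⟨S, rfl⟩ | ⟨S, rfl⟩
    · rw [adj_eq]
      apply pm_mem
      intro i
      split_ifs
      · exact sub_mem (JJ_mem F (x i)) (one_mem_LS F (x i))
      · exact one_mem_LS F (x i)
    · rw [dual_eq]
      exact pm_mem F x _ fun i => diag_mem F (x i) _
  | algebraMap r =>
    rw [Algebra.algebraMap_eq_smul_one]
    exact Submodule.smul_mem _ _ (one_mem_NN F x)
  | add a b _ _ ha hb => exact add_mem ha hb
  | mul a b _ _ ha hb => exact NN_mul F x 0 0 ha hb

/-- embedding of a coordinate -/
def io (a : Fin n) (m : Matrix (U a) (U a) F) : Matrix (∀ i, U i) (∀ i, U i) F :=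
  pm F (Function.update (fun i => (1 : Matrix (U i) (U i) F)) a m)

lemma io_apply (a : Fin n) (m : Matrix (U a) (U a) F) (y z : ∀ i, U i) :
    io F a m y z = m (y a) (z a) *
      ∏ i ∈ univ.erase a, (1 : Matrix (U i) (U i) F) (y i) (z i) := by
  unfold io pm
  rw [← Finset.mul_prod_erase univ _ (Finset.mem_univ a)]
  congr 1
  · simp
  · refine Finset.prod_congr rfl fun i hi => ?_
    rw [Function.update_of_ne (Finset.ne_of_mem_erase hi)]

lemma io_add (a : Fin n) (m m' : Matrix (U a) (U a) F) :
    io F a (m + m') = io F a m + io F a m' := by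
  ext y z; simp [io_apply, add_mul]

lemma io_smul (a : Fin n) (c : F) (m : Matrix (U a) (U a) F) :
    io F a (c • m) = c • io F a m := by
  ext y z; simp [io_apply, mul_assoc]

lemma io_mul (a : Fin n) (m m' : Matrix (U a) (U a) F) :
    io F a (m * m') = io F a m * io F a m' := by
  unfold io
  rw [pm_mul]
  congr 1
  ext1 i
  by_cases h : i = a
  · subst h; simp
  · simp [Function.update_of_ne h]

lemma io_one (a : Fin n) : io F a (1 : Matrix (U a) (U a) F) = 1 := by
  unfold io
  rw [← pm_one]
  congr 1
  ext1 i
  by_cases h : i = a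
  · subst h; simp
  · simp [Function.update_of_ne h]

lemma io_J (x : ∀ i, U i) (a : Fin n) : io F a (JJ F (U a)) ∈ TerwAlg F x := by
  have h1 : JJ F (U a) = (JJ F (U a) - 1) + 1 := by simp
  have h2 : io F a (JJ F (U a) - 1) = adjMat F {a} := by
    rw [adj_eq]; unfold io
    congr 1
    ext1 i
    by_cases h : i = a
    · subst h; simp
    · simp [Function.update_of_ne h, h]
  rw [h1, io_add, io_one, h2]
  exact add_mem (Algebra.subset_adjoin (Or.inl ⟨_, rfl⟩)) (one_mem _)

lemma io_D (x : ∀ i, U i) (a : Fin n) (b : Bool) :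
    io F a (Matrix.diagonal (vv F (x a) b)) ∈ TerwAlg F x := by
  have : io F a (Matrix.diagonal (vv F (x a) b)) =
      ∑ S : Finset (Fin n), if decide (a ∈ S) = b then dualIdem F x S else 0 := by
    ext y z
    rw [io_apply, Matrix.sum_apply, Finset.sum_eq_single (Dst x y)]
    · by_cases h : y = z
      · subst h
        simp only [Matrix.one_apply_eq, Finset.prod_const_one, Matrix.diagonal_apply_eq, mul_one]
        by_cases h : y a = x a <;> cases b <;>
          simp [vv, Dst, h, dualIdem, Ne.symm, eq_comm]
      · obtain ⟨i, hi⟩ := Function.ne_iff.1 h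
        have h0 : (if decide (a ∈ Dst x y) = b then dualIdem F x (Dst x y) else 0) y z = 0 := by
          split_ifs
          · simp [dualIdem, h]
          · rfl
        rw [h0]
        by_cases hia : i = a
        · subst hia; simp [hi]
        · rw [Finset.prod_eq_zero (i := i) (by simp [hia]) (by simp [hi]), mul_zero]
    · intro S _ hS
      split_ifs
      · rw [dualIdem, Matrix.diagonal_apply]
        simp [hS.symm]
      · rfl
    · simp
  rw [this]
  refine sum_mem fun S _ => ?_
  split_ifs
  · exact Algebra.subset_adjoin (Or.inr ⟨_, rfl⟩)
  · exact zero_mem _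

lemma io_B (x : ∀ i, U i) (a : Fin n) (s : Option (Bool × Bool)) :
    io F a (BB F (x a) s) ∈ TerwAlg F x := by
  have he : ∀ i j, io F a (ee F (x a) i j) ∈ TerwAlg F x := by
    intro i j
    rw [ee_eq_JJ, io_mul, io_mul]
    exact mul_mem (mul_mem (io_D F x a _) (io_J F x a)) (io_D F x a _)
  rcases s with _ | ⟨i, j⟩
  · simp only [BB, ff]
    rw [sub_eq_add_neg, ← neg_smul, io_add, io_smul]
    exact add_mem (io_D F x a _) (Subalgebra.smul_mem _ (he _ _) _)
  · exact he i j

lemma PB_T (x : ∀ i, U i) (t : Ty n) : PB F x t ∈ TerwAlg F x := by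
  have key : ∀ s : Finset (Fin n),
      pm F (fun i => if i ∈ s then BB F (x i) (t i) else 1) ∈ TerwAlg F x := by
    intro s
    induction s using Finset.induction_on with
    | empty => simp only [Finset.notMem_empty, if_false]; rw [pm_one]; exact one_mem _
    | insert a s ha ih =>
      have : pm F (fun i => if i ∈ insert a s then BB F (x i) (t i) else 1) =
          io F a (BB F (x a) (t a)) * pm F (fun i => if i ∈ s then BB F (x i) (t i) else 1) := by
        unfold io
        rw [pm_mul]
        congr 1
        ext1 i
        by_cases h : i = a
        · subst h; simp [ha]
        · simp [Function.update_of_ne h, h]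
      rw [this]
      exact mul_mem (io_B F x a _) ih
  simpa [PB] using key univ

lemma NN_T (x : ∀ i, U i) (k : ℕ) {M : Matrix (∀ i, U i) (∀ i, U i) F} (h : M ∈ NN F x k) :
    M ∈ TerwAlg F x := by
  have : NN F x k ≤ (TerwAlg F x).toSubmodule := by
    unfold NN
    rw [Submodule.span_le]
    rintro _ ⟨t, _, rfl⟩
    exact PB_T F x t
  exact this h

open Classical in
lemma NN_top (x : ∀ i, U i) (c : ℕ) (hc : c = (univ.filter fun a => ep F (U a) = 0).card)
    {M : Matrix (∀ i, U i) (∀ i, U i) F} (h : M ∈ NN F x (2 * c + 1)) : M = 0 := by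
  have hw : ∀ t : Ty n, wt F U t ≤ 2 * c := by
    intro t
    unfold wt ww
    rw [← Finset.sum_filter, hc, mul_comm, ← smul_eq_mul]
    exact Finset.sum_le_card_nsmul _ _ _ fun i _ => w0_le _
  have : {M | ∃ t : Ty n, 2 * c + 1 ≤ wt F U t ∧ PB F x t = M} = ∅ := by
    ext M
    simp only [Set.mem_ofPred_eq, Set.mem_empty_iff_false, iff_false]
    rintro ⟨t, ht, _⟩
    have := hw t
    omega
  unfold NN at h
  rw [this] at h
  simpa using h

lemma list_NN (x : ∀ i, U i) (l : List (TerwAlg F x))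
    (h : ∀ a ∈ l, (a : Matrix (∀ i, U i) (∀ i, U i) F) ∈ NN F x 1) :
    (l.prod : Matrix (∀ i, U i) (∀ i, U i) F) ∈ NN F x l.length := by
  induction l with
  | nil => exact one_mem_NN F x
  | cons a l ih =>
    rw [List.prod_cons, List.length_cons, add_comm]
    exact NN_mul F x 1 _ (h a (by simp)) (ih fun b hb => h b (by simp [hb]))

lemma jac_le (x : ∀ i, U i) (r : TerwAlg F x) (hr : r ∈ Ideal.jacobson (⊥ : Ideal (TerwAlg F x))) :
    (r : Matrix (∀ i, U i) (∀ i, U i) F) ∈ NN F x 1 := by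
  have h0 := T_le F x r.2
  have h1 : (r : Matrix (∀ i, U i) (∀ i, U i) F) ∈ Submodule.span F (Set.range (PB F x)) := by
    refine Submodule.span_mono ?_ h0
    rintro _ ⟨t, _, rfl⟩
    exact ⟨t, rfl⟩
  obtain ⟨c, hc⟩ := (Submodule.mem_span_range_iff_exists_fun F).1 h1
  rw [← hc]
  refine Submodule.sum_mem _ fun t _ => ?_
  by_cases hct : c t = 0
  · rw [hct, zero_smul]; exact zero_mem _
  refine Submodule.smul_mem _ _ ?_
  by_cases hwt : 1 ≤ wt F U t
  · exact PB_mem F x t 1 hwt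
  have hw : ∀ s : Ty n, ¬ 1 ≤ wt F U s → ∀ i, ww F (U i) (s i) = 0 := by
    intro s hs i
    have : wt F U s = 0 := by omega
    unfold wt at this
    exact (Finset.sum_eq_zero_iff.1 this) i (Finset.mem_univ i)
  have hself := fun i => sand_self F (x i) (t i) (hw t hwt i)
  choose K hK0 hK using hself
  let L : TerwAlg F x := ⟨PB F x (fun i => lef (t i)), PB_T F x _⟩
  let R : TerwAlg F x := ⟨PB F x (fun i => rig (t i)), PB_T F x _⟩
  let P : TerwAlg F x := ⟨PB F x (fun i => pp (t i)), PB_T F x _⟩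
  have hP : P * P = P := by
    apply Subtype.ext
    change PB F x _ * PB F x _ = PB F x _
    simp only [PB, pm_mul, pp_idem]
  have hrec : PB F x (fun i => lef' (t i)) * (P : Matrix (∀ i, U i) (∀ i, U i) F) *
      PB F x (fun i => rig' (t i)) = PB F x t := by
    change PB F x _ * PB F x _ * PB F x _ = PB F x _
    simp only [PB, pm_mul, recov]
  suffices hPN : (P : Matrix (∀ i, U i) (∀ i, U i) F) ∈ NN F x 1 by
    rw [← hrec]
    have := NN_mul F x _ _ (NN_mul F x _ _ (PB_mem F x (fun i => lef' (t i)) 0 (Nat.zero_le _)) hPN)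
      (PB_mem F x (fun i => rig' (t i)) 0 (Nat.zero_le _))
    simpa using this
  have hprod : (∏ i, K i) ≠ 0 := Finset.prod_ne_zero_iff.2 fun i _ => hK0 i
  -- the sandwich
  have hsand : (L * r * R : Matrix (∀ i, U i) (∀ i, U i) F) -
      (c t * ∏ i, K i) • (P : Matrix (∀ i, U i) (∀ i, U i) F) ∈ NN F x 1 := by
    rw [← hc, Finset.mul_sum, Finset.sum_mul, ← Finset.add_sum_erase univ _ (Finset.mem_univ t)]
    have e1 : (L : Matrix (∀ i, U i) (∀ i, U i) F) * (c t • PB F x t) * R =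
        (c t * ∏ i, K i) • (P : Matrix (∀ i, U i) (∀ i, U i) F) := by
      rw [mul_smul_comm, smul_mul_assoc, mul_smul]
      congr 1
      change PB F x _ * PB F x _ * PB F x _ = _ • PB F x _
      simp only [PB, pm_mul, hK, pm_smul]
    rw [e1, add_sub_cancel_left]
    refine Submodule.sum_mem _ fun s hs => ?_
    rw [mul_smul_comm, smul_mul_assoc]
    refine Submodule.smul_mem _ _ ?_
    by_cases hws : 1 ≤ wt F U s
    · have := NN_mul F x _ _ (NN_mul F x _ _ (PB_mem F x (fun i => lef (t i)) 0 (Nat.zero_le _))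
        (PB_mem F x s 1 hws)) (PB_mem F x (fun i => rig (t i)) 0 (Nat.zero_le _))
      simpa using this
    · obtain ⟨i, hi⟩ := Function.ne_iff.1 (Finset.ne_of_mem_erase hs)
      have : (L : Matrix (∀ i, U i) (∀ i, U i) F) * PB F x s * R = 0 := by
        change PB F x _ * PB F x _ * PB F x _ = 0
        simp only [PB, pm_mul]
        exact pm_zero F _ i (sand_ne F (x i) (t i) (s i) (hw t hwt i) (hw s hws i) hi)
      rw [this]; exact zero_mem _
  set k : F := c t * ∏ i, K i with hk
  have hk0 : k ≠ 0 := mul_ne_zero hct hprod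
  let q : TerwAlg F x := k⁻¹ • (L * r * R)
  have hq : -q ∈ Ideal.jacobson (⊥ : Ideal (TerwAlg F x)) := by
    refine neg_mem ?_
    have : q = (k⁻¹ • L) * r * R := by simp [q]
    rw [this]
    exact Ideal.mul_mem_right _ _ (Ideal.mul_mem_left _ _ hr)
  have hqP : ((q - P : TerwAlg F x) : Matrix (∀ i, U i) (∀ i, U i) F) ∈ NN F x 1 := by
    have := Submodule.smul_mem _ k⁻¹ hsand
    rw [smul_sub, smul_smul, inv_mul_cancel₀ hk0, one_smul] at this
    exact this
  obtain ⟨z, hz⟩ := Ideal.exists_mul_add_sub_mem_of_mem_jacobson _ hq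
  rw [Ideal.mem_bot, sub_eq_zero] at hz
  have hfin : P = -(z * (q - P) * P) := by
    calc P = z * (-q + 1) * P := by rw [hz, one_mul]
      _ = -(z * (q - P) * P) + z * (P - P * P) := ring_aux z q P
      _ = _ := by rw [hP]; simp
  rw [hfin]
  have := NN_mul F x _ _ (NN_mul F x _ _ (T_le F x z.2) hqP) (T_le F x P.2)
  exact neg_mem (by simpa using this)

open Classical in
lemma le_jac (x : ∀ i, U i) (r : TerwAlg F x)
    (hr : (r : Matrix (∀ i, U i) (∀ i, U i) F) ∈ NN F x 1) :
    r ∈ Ideal.jacobson (⊥ : Ideal (TerwAlg F x)) := by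
  rw [Ideal.mem_jacobson_iff]
  intro y
  have hnil : IsNilpotent (y * r) := by
    refine ⟨2 * (univ.filter fun a => ep F (U a) = 0).card + 1, ?_⟩
    apply Subtype.ext
    apply NN_top F x _ rfl
    have := list_NN F x (List.replicate (2 * (univ.filter fun a => ep F (U a) = 0).card + 1)
      (y * r)) (by
        intro a ha
        rw [List.eq_of_mem_replicate ha]
        simpa using NN_mul F x _ _ (T_le F x y.2) hr)
    simpa using this
  obtain ⟨v, hv⟩ := hnil.isUnit_add_one.exists_left_inv
  refine ⟨v, ?_⟩
  rw [Ideal.mem_bot, ← hv]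
  noncomm_ring

open Classical in
noncomputable def chain (U : Fin n → Type*) [∀ i, Fintype (U i)] (s : Finset (Fin n))
    (o : Option (Bool × Bool)) : Ty n :=
  fun i => if i ∈ s then o else if ep F (U i) = 0 then none else some (false, false)

lemma wt_chain (a : Fin n) (ha : ep F (U a) = 0) (o : Option (Bool × Bool)) (ho : 1 ≤ w0 o) :
    1 ≤ wt F U (chain F U {a} o) := by
  unfold wt
  refine le_trans ?_ (Finset.single_le_sum (fun _ _ => Nat.zero_le _) (Finset.mem_univ a))
  simpa [chain, ww, ha] using ho

lemma exists_list (x : ∀ i, U i) (s : Finset (Fin n)) (hs : ∀ a ∈ s, ep F (U a) = 0) :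
    ∃ l : List (TerwAlg F x), l.length = 2 * s.card ∧
      (∀ a ∈ l, a ∈ Ideal.jacobson (⊥ : Ideal (TerwAlg F x))) ∧
      (l.prod : Matrix (∀ i, U i) (∀ i, U i) F) * PB F x (chain F U ∅ none) =
        PB F x (chain F U s (some (true, true))) := by
  induction s using Finset.induction_on with
  | empty =>
    refine ⟨[], by simp, by simp, ?_⟩
    rw [List.prod_nil, OneMemClass.coe_one, one_mul]
    congr 1
  | insert a s ha ih =>
    obtain ⟨l, h1, h2, h3⟩ := ih fun b hb => hs b (by simp [hb])
    have hea := hs a (by simp)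
    let C : TerwAlg F x := ⟨PB F x (chain F U {a} (some (true, false))), PB_T F x _⟩
    let B : TerwAlg F x := ⟨PB F x (chain F U {a} (some (false, true))), PB_T F x _⟩
    refine ⟨C :: B :: l, ?_, ?_, ?_⟩
    · simp [h1, Finset.card_insert_of_notMem ha]; ring
    · intro b hb
      simp only [List.mem_cons] at hb
      rcases hb with rfl | rfl | hb
      · exact le_jac F x _ (PB_mem F x _ 1 (wt_chain F a hea _ (by simp [w0])))
      · exact le_jac F x _ (PB_mem F x _ 1 (wt_chain F a hea _ (by simp [w0])))
      · exact h2 b hb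
    · rw [List.prod_cons, List.prod_cons]
      have : ((C * (B * l.prod) : TerwAlg F x) : Matrix (∀ i, U i) (∀ i, U i) F) *
          PB F x (chain F U ∅ none) = C * (B * (l.prod * PB F x (chain F U ∅ none))) := by
        simp [mul_assoc]
      rw [this, h3]
      change PB F x _ * (PB F x _ * PB F x _) = PB F x _
      simp only [PB, pm_mul]
      congr 1
      ext1 i
      by_cases hia : i = a
      · subst hia
        simp [chain, ha, hea, BB, ee_bad, ee_mul, mu]
      · by_cases his : i ∈ s
        · have := hs i (by simp [his])
          simp [chain, hia, his, this, BB, ff_bad]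
        · by_cases hb : ep F (U i) = 0
          · simp [chain, hia, his, hb, BB, ff_ff]
          · simp [chain, hia, his, hb, BB, ee_mul, mu]

lemma PB_ne (x : ∀ i, U i) (h2 : ∀ i, 2 ≤ Fintype.card (U i)) (s : Finset (Fin n))
    (hs : ∀ a, a ∈ s ↔ ep F (U a) = 0) : PB F x (chain F U s (some (true, true))) ≠ 0 := by
  have h : ∀ i, ∃ y : U i, BB F (x i) (chain F U s (some (true, true)) i) y y ≠ 0 := by
    intro i
    by_cases hi : i ∈ s
    · haveI : Nontrivial (U i) := Fintype.one_lt_card_iff_nontrivial.1 (h2 i)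
      obtain ⟨y, hy⟩ := exists_ne (x i)
      exact ⟨y, by simp [chain, hi, BB, ee, Matrix.vecMulVec_apply, vv, hy]⟩
    · have : ¬ ep F (U i) = 0 := fun h => hi ((hs i).2 h)
      exact ⟨x i, by simp [chain, hi, this, BB, ee, Matrix.vecMulVec_apply, vv]⟩
  choose y hy using h
  intro h0
  have := congrFun (congrFun h0 y) y
  exact Finset.prod_ne_zero_iff.2 (fun i (_ : i ∈ univ) => hy i) this

end Global

set_option synthInstance.maxHeartbeats 1000000 in
theorem stmt_18 (hn : 1 ≤ n) (u : Fin n → ℕ) (hu : ∀ i, Fintype.card (U i) = u i)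
    (h2 : ∀ i, 2 ≤ u i) (x : ∀ i, U i) (p : ℕ) (hp : p.Prime) (hchar : CharP F p)
    (c : ℕ) (hc : c = ((univ : Finset (Fin n)).filter (fun a => u a ≡ 1 [MOD p])).card)
    (hne : 0 < c) :
    (∀ f : Fin (2 * c + 1) → ↥(TerwAlg F x),
        (∀ i, f i ∈ Ideal.jacobson (⊥ : Ideal ↥(TerwAlg F x))) →
        (List.ofFn f).prod = 0) ∧
      ∃ f : Fin (2 * c) → ↥(TerwAlg F x),
        (∀ i, f i ∈ Ideal.jacobson (⊥ : Ideal ↥(TerwAlg F x))) ∧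
        (List.ofFn f).prod ≠ 0 := by
  classical
  have hbad : ∀ a, ep F (U a) = 0 ↔ u a ≡ 1 [MOD p] := by
    intro a
    rw [ep, sub_eq_zero, hu, ← CharP.natCast_eq_natCast F p, Nat.cast_one]
  have hc' : c = (univ.filter fun a => ep F (U a) = 0).card := by
    rw [hc]
    congr 1
    ext a
    simp [hbad]
  refine ⟨fun f hf => ?_, ?_⟩
  · apply Subtype.ext
    apply NN_top F x c hc'
    have := list_NN F x (List.ofFn f) (by
      intro a ha
      obtain ⟨i, rfl⟩ := (List.mem_ofFn' f a).1 ha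
      exact jac_le F x _ (hf i))
    rwa [List.length_ofFn] at this
  · obtain ⟨l, h1, h3, h4⟩ := exists_list F x (univ.filter fun a => ep F (U a) = 0) (by simp)
    rw [← hc'] at h1
    rw [← h1]
    refine ⟨l.get, fun i => h3 _ (List.get_mem l i), ?_⟩
    rw [List.ofFn_get]
    intro h0
    rw [h0] at h4
    refine PB_ne F x (fun i => (hu i).symm ▸ h2 i) _ (by simp) (h4.symm.trans ?_)
    simp
end
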